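/- arXiv:math/0206214 — 2 statements merged into one kernel-verified Lean document; each statement's English description precedes it below -/
import Mathlib

section
/- Let n ≥ 1, let a = (a₁,…,aₙ) ∈ 𝔻ⁿ, let c₁,…,cₙ be positive integers, set m := ∏ⱼ cⱼ and mⱼ := m/cⱼ. Then for every z ∈ 𝔻ⁿ there exist a holomorphic map φ = (φ₁,…,φₙ) : 𝔻 → 𝔻ⁿ and ζ₀ ∈ 𝔻 such that φ(0) = z, for each 1 ≤ j ≤ n the function φⱼ − aⱼ vanishes at ζ₀ to order at least mⱼ, and m·log|ζ₀| = max_{1≤j≤n} cⱼ·log|φ_{aⱼ}(zⱼ)| (with the convention log 0 = −∞). In other words, the extremal disc for the generalized Lempert function with one pole a and indicator Ψ(w) = max_j cⱼ log|wⱼ| in the polydisc exists and attains the value of the Green function. -/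
open Complex Metric Filter Topology

noncomputable section

/-- The open unit disc in `ℂ`. -/
def unitDisc : Set ℂ := Metric.ball 0 1

/-- Extended-real logarithm, with the convention `log 0 = ⊥`. -/
def elog (x : ℝ) : EReal := if x = 0 then ⊥ else ((Real.log x : ℝ) : EReal)

/-- The Möbius involution of the unit disc exchanging `ξ` and `0`. -/
def mobius (ξ ζ : ℂ) : ℂ := (ξ - ζ) / (1 - (starRingEnd ℂ) ξ * ζ)


lemma mem_uD {w : ℂ} : w ∈ unitDisc ↔ ‖w‖ < 1 := by simp [unitDisc]

lemma den_ne {a u : ℂ} (ha : a ∈ unitDisc) (hu : u ∈ unitDisc) :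
    1 - (starRingEnd ℂ) a * u ≠ 0 := by
  rw [mem_uD] at ha hu
  intro h
  have h1 : (starRingEnd ℂ) a * u = 1 := (sub_eq_zero.mp h).symm
  have h2 : ‖a‖ * ‖u‖ = 1 := by
    have := congrArg norm h1
    simpa using this
  nlinarith [norm_nonneg a, norm_nonneg u]

lemma mobius_mem {a u : ℂ} (ha : a ∈ unitDisc) (hu : u ∈ unitDisc) :
    mobius a u ∈ unitDisc := by
  have hd := den_ne ha hu
  rw [mem_uD] at *
  rw [mobius, norm_div, div_lt_one (norm_pos_iff.mpr hd)]
  apply lt_of_pow_lt_pow_left₀ 2 (norm_nonneg _)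
  have h1 : ‖a‖ ^ 2 < 1 := by nlinarith [norm_nonneg a]
  have h2 : ‖u‖ ^ 2 < 1 := by nlinarith [norm_nonneg u]
  have h3 : 0 < (1 - ‖a‖ ^ 2) * (1 - ‖u‖ ^ 2) := mul_pos (by linarith) (by linarith)
  simp only [← Complex.normSq_eq_norm_sq, Complex.normSq_apply] at *
  simp at *
  nlinarith

lemma mobius_mobius {a u : ℂ} (ha : a ∈ unitDisc) (hu : u ∈ unitDisc) :
    mobius a (mobius a u) = u := by
  have hd := den_ne ha hu
  have hd2 := den_ne ha (mobius_mem ha hu)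
  have hd3 := den_ne ha ha
  rw [mobius, div_eq_iff hd2]
  have e : mobius a u * (1 - (starRingEnd ℂ) a * u) = a - u := div_mul_cancel₀ _ hd
  linear_combination -e

lemma mobius_diff {a : ℂ} (ha : a ∈ unitDisc) : DifferentiableOn ℂ (mobius a) unitDisc := by
  intro w hw
  have := den_ne ha hw
  unfold mobius
  apply DifferentiableAt.differentiableWithinAt
  fun_prop (disch := assumption)

lemma elog_mono {x y : ℝ} (hx : 0 ≤ x) (h : x ≤ y) : elog x ≤ elog y := by
  unfold elog
  split_ifs with h1 h2 h2
  · exact le_rfl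
  · exact bot_le
  · exact absurd (le_antisymm (h2 ▸ h) hx) h1
  · exact_mod_cast Real.log_le_log (lt_of_le_of_ne hx (Ne.symm h1)) h

lemma mul_elog_pow {r : ℝ} {c k : ℕ} (hc : 0 < c) (hk : 0 < k) :
    ((c : ℝ) : EReal) * elog (r ^ k) = (((c * k : ℕ) : ℝ) : EReal) * elog r := by
  have h1 : (0 : ℝ) < c := by exact_mod_cast hc
  have h2 : (0 : ℝ) < ((c * k : ℕ) : ℝ) := by exact_mod_cast Nat.mul_pos hc hk
  unfold elog
  by_cases hr : r = 0
  · subst hr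
    rw [zero_pow hk.ne', if_pos rfl, EReal.coe_mul_bot_of_pos h1, EReal.coe_mul_bot_of_pos h2]
  · rw [if_neg hr, if_neg (pow_ne_zero _ hr), Real.log_pow, ← EReal.coe_mul, ← EReal.coe_mul]
    push_cast
    rw [mul_assoc]

lemma exists_radius (n : ℕ) (hn : 1 ≤ n) (x : Fin n → ℝ) (hx : ∀ j, 0 ≤ x j) (hx1 : ∀ j, x j < 1)
    (k : Fin n → ℕ) (hk : ∀ j, 0 < k j) :
    ∃ r : ℝ, 0 ≤ r ∧ r < 1 ∧ (∀ j, x j ≤ r ^ k j) ∧ ∃ j, x j = r ^ k j := by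
  have : Nonempty (Fin n) := ⟨⟨0, hn⟩⟩
  obtain ⟨i, hi⟩ := Finite.exists_max (fun j => (x j) ^ ((k j : ℝ)⁻¹))
  have key : ∀ j, (x j ^ ((k j : ℝ)⁻¹)) ^ k j = x j := fun j =>
    Real.rpow_inv_natCast_pow (hx j) (hk j).ne'
  have h0 : ∀ j, 0 ≤ x j ^ ((k j : ℝ)⁻¹) := fun j => Real.rpow_nonneg (hx j) _
  refine ⟨x i ^ ((k i : ℝ)⁻¹), h0 i, ?_, fun j => ?_, i, (key i).symm⟩
  · apply Real.rpow_lt_one (hx i) (hx1 i)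
    have := hk i
    positivity
  · calc x j = _ := (key j).symm
      _ ≤ _ := pow_le_pow_left₀ (h0 j) (hi j) _

lemma inner_mem {r u l : ℂ} {k : ℕ} (hk : 0 < k) (hr : r ∈ unitDisc) (hl : ‖l‖ ≤ 1)
    (hu : u ∈ unitDisc) : mobius r u ^ k * l ∈ unitDisc := by
  have h := mobius_mem hr hu
  rw [mem_uD] at *
  rw [norm_mul, norm_pow]
  have h1 : ‖mobius r u‖ ^ k < 1 := pow_lt_one₀ (norm_nonneg _) h hk.ne'
  calc _ ≤ ‖mobius r u‖ ^ k * 1 := by gcongr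
    _ < 1 := by simpa

lemma comp_diff {a r l : ℂ} {k : ℕ} (hk : 0 < k) (ha : a ∈ unitDisc) (hr : r ∈ unitDisc)
    (hl : ‖l‖ ≤ 1) :
    DifferentiableOn ℂ (fun w => mobius a (mobius r w ^ k * l)) unitDisc :=
  (mobius_diff ha).comp (((mobius_diff hr).pow k).mul_const l)
    (fun _ hu => inner_mem hk hr hl hu)

lemma uD_nhds {r : ℂ} (hr : r ∈ unitDisc) : unitDisc ∈ 𝓝 r := Metric.isOpen_ball.mem_nhds hr

lemma comp_vanish {a r l : ℂ} {k : ℕ} (hk : 0 < k) (ha : a ∈ unitDisc) (hr : r ∈ unitDisc)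
    (hl : ‖l‖ ≤ 1) :
    ∀ i < k, iteratedDeriv i (fun w => mobius a (mobius r w ^ k * l) - a) r = 0 := by
  have hA : AnalyticAt ℂ (fun w => mobius a (mobius r w ^ k * l) - a) r :=
    ((comp_diff hk ha hr hl).sub_const a).analyticAt (uD_nhds hr)
  rw [← natCast_le_analyticOrderAt_iff_iteratedDeriv_eq_zero hA, natCast_le_analyticOrderAt hA]
  refine ⟨fun w => (-1 / (1 - (starRingEnd ℂ) r * w)) ^ k * l * ((starRingEnd ℂ) a * a - 1) /
    (1 - (starRingEnd ℂ) a * (mobius r w ^ k * l)), ?_, ?_⟩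
  · refine DifferentiableOn.analyticAt (s := unitDisc) ?_ (uD_nhds hr)
    intro w hw
    have h1 := den_ne hr hw
    have h2 := den_ne ha (inner_mem hk hr hl hw)
    have h3 : DifferentiableAt ℂ (mobius r) w := (mobius_diff hr).differentiableAt (uD_nhds hw)
    apply DifferentiableAt.differentiableWithinAt
    fun_prop (disch := assumption)
  · filter_upwards [uD_nhds hr] with w hw
    have h1 := den_ne hr hw
    have h2 := den_ne ha (inner_mem hk hr hl hw)
    have h4 : mobius r w ^ k = (w - r) ^ k * (-1 / (1 - (starRingEnd ℂ) r * w)) ^ k := by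
      rw [← mul_pow]
      congr 1
      unfold mobius
      field_simp
      ring
    rw [smul_eq_mul, mul_div_assoc', ← mul_assoc, ← mul_assoc, ← h4]
    generalize mobius r w ^ k * l = u at *
    unfold mobius
    rw [eq_div_iff h2, sub_mul, div_mul_cancel₀ _ h2]
    ring

/-- Existence of an extremal disc for the generalized Lempert function on the polydisc
with one pole `a` and indicator `Ψ(w) = max_j c_j log|w_j|`, attaining the value of
the Green function. -/
theorem exists_extremal_disc_polydisc_one_pole
    (n : ℕ) (hn : 1 ≤ n) (a : Fin n → ℂ) (ha : ∀ j, a j ∈ unitDisc)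
    (c : Fin n → ℕ) (hc : ∀ j, 0 < c j) (m : ℕ) (hm : m = ∏ j, c j)
    (z : Fin n → ℂ) (hz : ∀ j, z j ∈ unitDisc) :
    ∃ (φ : ℂ → Fin n → ℂ) (ζ₀ : ℂ), ζ₀ ∈ unitDisc ∧
      (∀ j, DifferentiableOn ℂ (fun w => φ w j) unitDisc) ∧
      (∀ w ∈ unitDisc, ∀ j, φ w j ∈ unitDisc) ∧
      φ 0 = z ∧
      (∀ j, ∀ k < m / c j, iteratedDeriv k (fun w => φ w j - a j) ζ₀ = 0) ∧
      ((m : ℝ) : EReal) * elog ‖ζ₀‖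
        = ⨆ j, ((c j : ℝ) : EReal) * elog ‖mobius (a j) (z j)‖ := by
  have hdvd : ∀ j, c j ∣ m := fun j => hm ▸ Finset.dvd_prod_of_mem c (Finset.mem_univ j)
  have hmpos : 0 < m := hm ▸ Finset.prod_pos (fun j _ => hc j)
  have hk : ∀ j, 0 < m / c j := fun j => Nat.div_pos (Nat.le_of_dvd hmpos (hdvd j)) (hc j)
  have hcm : ∀ j, c j * (m / c j) = m := fun j => Nat.mul_div_cancel' (hdvd j)
  have hw : ∀ j, mobius (a j) (z j) ∈ unitDisc := fun j => mobius_mem (ha j) (hz j)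
  obtain ⟨r, hr0, hr1, hle, i, hi⟩ := exists_radius n hn (fun j => ‖mobius (a j) (z j)‖)
    (fun j => norm_nonneg _) (fun j => mem_uD.mp (hw j)) (fun j => m / c j) hk
  have hnr : ‖(r : ℂ)‖ = r := by simp [abs_of_nonneg hr0]
  have hr : (r : ℂ) ∈ unitDisc := by rw [mem_uD, hnr]; exact hr1
  have hl : ∀ j, ‖mobius (a j) (z j) / (r : ℂ) ^ (m / c j)‖ ≤ 1 := fun j => by
    rw [norm_div, norm_pow, hnr]
    exact div_le_one_of_le₀ (hle j) (by positivity)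
  refine ⟨fun w j => mobius (a j) (mobius r w ^ (m / c j) *
    (mobius (a j) (z j) / (r : ℂ) ^ (m / c j))), r, hr, fun j => comp_diff (hk j) (ha j) hr (hl j),
    fun w hw j => mobius_mem (ha j) (inner_mem (hk j) hr (hl j) hw), ?_,
    fun j => comp_vanish (hk j) (ha j) hr (hl j), ?_⟩
  · funext j
    have h0 : mobius r 0 = r := by simp [mobius]
    have h1 : (r : ℂ) ^ (m / c j) * (mobius (a j) (z j) / (r : ℂ) ^ (m / c j))
        = mobius (a j) (z j) := by
      apply mul_div_cancel_of_imp'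
      intro h
      have h2 : r ^ (m / c j) = 0 := by exact_mod_cast h
      have h3 := hle j
      simp only [h2] at h3
      exact norm_le_zero_iff.mp h3
    simp only [h0, h1]
    exact mobius_mobius (ha j) (hz j)
  · rw [hnr]
    apply le_antisymm
    · refine le_trans (le_of_eq ?_) (le_iSup _ i)
      rw [hi, mul_elog_pow (hc i) (hk i), hcm]
    · refine iSup_le fun j => ?_
      calc _ ≤ ((c j : ℝ) : EReal) * elog (r ^ (m / c j)) :=
            mul_le_mul_of_nonneg_left (elog_mono (norm_nonneg _) (hle j))
              (by exact_mod_cast (Nat.zero_le (c j)))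
        _ = _ := by rw [mul_elog_pow (hc j) (hk j), hcm]
end
end

section
/- Let a₁,…,a_N ∈ 𝔻 be distinct points and m₁,…,m_N positive integers. For z = (z₁,z₂) ∈ 𝔻² define L(z) := inf{ Σ_{j=1}^N mⱼ·log|ζⱼ| : there exist an analytic disc φ = (φ₁,φ₂) in 𝔻² and ζ₁,…,ζ_N ∈ 𝔻 such that φ(0) = z and, for each j, φ₁(ζⱼ) = aⱼ and φ₂ vanishes at ζⱼ to order at least mⱼ }. Then for every z = (z₁,z₂) ∈ 𝔻², L(z) = max{ Σ_{j=1}^N mⱼ·log|φ_{aⱼ}(z₁)| , log|z₂| } (with the convention log 0 = −∞). (This is the equality L_S = G_S on the bidisc for poles (aⱼ,0) with horizontal indicators Ψ_{mⱼ}(w) = max{mⱼ log|w₁|, log|w₂|}.) -/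
open Complex Metric Filter Topology

noncomputable section

/-- An analytic disc in the bidisc `𝔻²`, given by its two components. -/
def AnalyticDisc2 (φ₁ φ₂ : ℂ → ℂ) : Prop :=
  DifferentiableOn ℂ φ₁ unitDisc ∧ DifferentiableOn ℂ φ₂ unitDisc ∧
  (∀ w ∈ unitDisc, φ₁ w ∈ unitDisc) ∧ (∀ w ∈ unitDisc, φ₂ w ∈ unitDisc)

lemma mob_den {ξ w : ℂ} (hξ : ξ ∈ unitDisc) (hw : w ∈ unitDisc) :
    1 - (starRingEnd ℂ) ξ * w ≠ 0 := by
  rw [mem_uD] at *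
  intro h
  have h1 : (starRingEnd ℂ) ξ * w = 1 := (sub_eq_zero.mp h).symm
  have h2 : ‖ξ‖ * ‖w‖ = 1 := by
    have := congrArg norm h1
    simpa using this
  nlinarith [norm_nonneg ξ, norm_nonneg w]

lemma mob_zero (ξ : ℂ) : mobius ξ 0 = ξ := by simp [mobius]

lemma mob_self (ξ : ℂ) : mobius ξ ξ = 0 := by simp [mobius]

lemma mob_mem {ξ w : ℂ} (hξ : ξ ∈ unitDisc) (hw : w ∈ unitDisc) : mobius ξ w ∈ unitDisc := by
  have hd := mob_den hξ hw
  rw [mem_uD] at *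
  have h0 : 0 < ‖1 - (starRingEnd ℂ) ξ * w‖ := norm_pos_iff.mpr hd
  rw [mobius, norm_div, div_lt_one h0]
  have h1 : ‖ξ - w‖ ^ 2 < ‖1 - (starRingEnd ℂ) ξ * w‖ ^ 2 := by
    have e : ‖1 - (starRingEnd ℂ) ξ * w‖ ^ 2 - ‖ξ - w‖ ^ 2 = (1 - ‖ξ‖ ^ 2) * (1 - ‖w‖ ^ 2) := by
      simp only [Complex.sq_norm, Complex.normSq_apply]
      simp
      ring
    have : 0 < (1 - ‖ξ‖ ^ 2) * (1 - ‖w‖ ^ 2) := by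
      apply mul_pos <;> nlinarith [norm_nonneg ξ, norm_nonneg w]
    linarith
  exact lt_of_pow_lt_pow_left₀ 2 h0.le h1

lemma mob_invol {ξ w : ℂ} (hξ : ξ ∈ unitDisc) (hw : w ∈ unitDisc) :
    mobius ξ (mobius ξ w) = w := by
  have hd := mob_den hξ hw
  have hd2 := mob_den hξ (mob_mem hξ hw)
  have hu : mobius ξ w * (1 - (starRingEnd ℂ) ξ * w) = ξ - w := div_mul_cancel₀ _ hd
  rw [mobius, div_eq_iff hd2]
  linear_combination -hu

lemma mob_norm_symm (ξ w : ℂ) : ‖mobius ξ w‖ = ‖mobius w ξ‖ := by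
  unfold mobius
  rw [norm_div, norm_div, norm_sub_rev]
  congr 1
  rw [← Complex.norm_conj]
  simp [mul_comm]

lemma mob_diff {ξ : ℂ} (hξ : ξ ∈ unitDisc) : DifferentiableOn ℂ (mobius ξ) unitDisc := by
  intro w hw
  have hd := mob_den hξ hw
  apply DifferentiableAt.differentiableWithinAt
  unfold mobius
  fun_prop (disch := exact hd)

lemma uD_open : IsOpen unitDisc := Metric.isOpen_ball

lemma uD_anal {f : ℂ → ℂ} (hf : DifferentiableOn ℂ f unitDisc) {w : ℂ} (hw : w ∈ unitDisc) :
    AnalyticAt ℂ f w := hf.analyticAt (uD_open.mem_nhds hw)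

/-- Division by a Blaschke factor. -/
lemma blaschke_div {φ : ℂ → ℂ} {ξ : ℂ} (hξ : ξ ∈ unitDisc) (hφ : DifferentiableOn ℂ φ unitDisc)
    (hb : ∀ w ∈ unitDisc, ‖φ w‖ ≤ 1) (h0 : φ ξ = 0) :
    ∃ g : ℂ → ℂ, DifferentiableOn ℂ g unitDisc ∧ (∀ w ∈ unitDisc, ‖g w‖ ≤ 1) ∧
      ∀ w ∈ unitDisc, φ w = mobius ξ w * g w := by
  have hm : Set.MapsTo (mobius ξ) unitDisc unitDisc := fun w hw => mob_mem hξ hw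
  set k := φ ∘ mobius ξ with hk
  have hkd : DifferentiableOn ℂ k unitDisc := hφ.comp (mob_diff hξ) hm
  have hk0 : k 0 = 0 := by simp [hk, mob_zero, h0]
  have h0m : (0 : ℂ) ∈ unitDisc := by simp [mem_uD]
  have hds : DifferentiableOn ℂ (dslope k 0) unitDisc :=
    (Complex.differentiableOn_dslope (uD_open.mem_nhds h0m)).mpr hkd
  refine ⟨dslope k 0 ∘ mobius ξ, hds.comp (mob_diff hξ) hm, ?_, ?_⟩
  · intro w hw
    have := Complex.norm_dslope_le_div_of_mapsTo_ball (f := k) (c := 0) (R₁ := 1) (R₂ := 1)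
      (z := mobius ξ w) hkd (by
        intro u hu
        rw [hk0, mem_closedBall_zero_iff]
        exact hb _ (hm hu)) (hm hw)
    simpa using this
  · intro w hw
    have := sub_smul_dslope k 0 (mobius ξ w)
    rw [hk0, sub_zero, sub_zero] at this
    simp only [smul_eq_mul] at this
    rw [Function.comp_apply, this, hk, Function.comp_apply, mob_invol hξ hw]

lemma mob_order_self {ξ : ℂ} (hξ : ξ ∈ unitDisc) : analyticOrderAt (mobius ξ) ξ = 1 := by
  have han := uD_anal (mob_diff hξ) hξ
  have hd := mob_den hξ hξ
  apply han.analyticOrderAt_eq_one_of_zero_deriv_ne_zero (mob_self ξ)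
  have : HasDerivAt (mobius ξ) (((-1) * (1 - (starRingEnd ℂ) ξ * ξ) -
      (ξ - ξ) * (-((starRingEnd ℂ) ξ * 1))) / (1 - (starRingEnd ℂ) ξ * ξ) ^ 2) ξ := by
    have h1 : HasDerivAt (fun w : ℂ => ξ - w) (-1) ξ := (hasDerivAt_id ξ).const_sub ξ
    have h2 : HasDerivAt (fun w : ℂ => 1 - (starRingEnd ℂ) ξ * w) (-((starRingEnd ℂ) ξ * 1)) ξ :=
      ((hasDerivAt_id ξ).const_mul _).const_sub 1
    exact h1.div h2 hd
  rw [this.deriv, sub_self, zero_mul, sub_zero]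
  exact div_ne_zero (mul_ne_zero (by norm_num) hd) (pow_ne_zero _ hd)

lemma mob_order_ne {ξ w : ℂ} (hξ : ξ ∈ unitDisc) (hw : w ∈ unitDisc) (h : ξ ≠ w) :
    analyticOrderAt (mobius ξ) w = 0 := by
  rw [(uD_anal (mob_diff hξ) hw).analyticOrderAt_eq_zero]
  exact div_ne_zero (sub_ne_zero.mpr h) (mob_den hξ hw)

/-- The Jensen-type bound. -/
lemma jensen_bound {N : ℕ} (ζ : Fin N → ℂ) (hζ : ∀ j, ζ j ∈ unitDisc)
    (hinj : Function.Injective ζ) (n : ℕ) : ∀ (M : Fin N → ℕ) (φ : ℂ → ℂ), ∑ j, M j = n →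
    DifferentiableOn ℂ φ unitDisc → (∀ w ∈ unitDisc, ‖φ w‖ ≤ 1) →
    (∀ j, (M j : ℕ∞) ≤ analyticOrderAt φ (ζ j)) → ‖φ 0‖ ≤ ∏ j, ‖ζ j‖ ^ M j := by
  have h0m : (0 : ℂ) ∈ unitDisc := by simp [mem_uD]
  induction n with
  | zero =>
    intro M φ hM hφ hb _
    have : ∀ j, M j = 0 := by simpa using hM
    simpa [this] using hb 0 h0m
  | succ n ih =>
    intro M φ hM hφ hb ho
    obtain ⟨i, hi⟩ : ∃ i, M i ≠ 0 := by
      by_contra! h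
      simp [h] at hM
    have hz : φ (ζ i) = 0 := by
      apply apply_eq_zero_of_analyticOrderAt_ne_zero
      intro h
      have := ho i
      rw [h] at this
      simp at this
      exact hi this
    obtain ⟨g, hg, hgb, hgm⟩ := blaschke_div (hζ i) hφ hb hz
    have hord : ∀ j, analyticOrderAt φ (ζ j) =
        analyticOrderAt (mobius (ζ i)) (ζ j) + analyticOrderAt g (ζ j) := by
      intro j
      rw [← analyticOrderAt_mul (uD_anal (mob_diff (hζ i)) (hζ j)) (uD_anal hg (hζ j))]
      apply analyticOrderAt_congr
      filter_upwards [uD_open.mem_nhds (hζ j)] with w hw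
      exact hgm w hw
    have hsplit : ∀ F : Fin N → ℕ, ∑ j, F j = F i + ∑ j ∈ Finset.univ.erase i, F j := fun F =>
      (Finset.add_sum_erase _ _ (Finset.mem_univ i)).symm
    have e1 : ∀ j ∈ Finset.univ.erase i, Function.update M i (M i - 1) j = M j := fun j hj =>
      Function.update_of_ne (Finset.ne_of_mem_erase hj) _ _
    have key := ih (Function.update M i (M i - 1)) g (by
        rw [hsplit, Finset.sum_congr rfl e1, Function.update_self]
        have hM2 := (hsplit M).symm.trans hM
        have hi' : 0 < M i := Nat.pos_of_ne_zero hi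
        change M i - 1 + ∑ j ∈ Finset.univ.erase i, M j = n
        omega) hg hgb (by
        intro j
        have h1 := ho j
        rw [hord j] at h1
        by_cases hj : j = i
        · subst hj
          rw [mob_order_self (hζ j)] at h1
          rw [Function.update_self]
          obtain ⟨k, hk⟩ := Nat.exists_eq_succ_of_ne_zero hi
          rw [hk] at h1 ⊢
          rw [Nat.succ_eq_add_one, Nat.cast_add, Nat.cast_one, add_comm] at h1
          simpa using (ENat.add_le_add_iff_left (by simp)).mp h1
        · rw [mob_order_ne (hζ i) (hζ j) (fun h => hj (hinj h).symm), zero_add] at h1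
          rwa [Function.update_of_ne hj])
    rw [hgm 0 h0m, mob_zero, norm_mul]
    rw [← Finset.mul_prod_erase _ _ (Finset.mem_univ i)] at key ⊢
    have e2 : ∏ j ∈ Finset.univ.erase i, ‖ζ j‖ ^ Function.update M i (M i - 1) j =
        ∏ j ∈ Finset.univ.erase i, ‖ζ j‖ ^ M j :=
      Finset.prod_congr rfl fun j hj => by rw [e1 j hj]
    rw [e2, Function.update_self] at key
    calc ‖ζ i‖ * ‖g 0‖ ≤ ‖ζ i‖ * (‖ζ i‖ ^ (M i - 1) * ∏ j ∈ Finset.univ.erase i, ‖ζ j‖ ^ M j) := by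
          gcongr
      _ = _ := by
          rw [← mul_assoc, ← pow_succ', Nat.sub_add_cancel (Nat.pos_of_ne_zero hi)]

/-- Schwarz–Pick against the origin. -/
lemma schwarz_pick {φ : ℂ → ℂ} {w : ℂ} (hφ : DifferentiableOn ℂ φ unitDisc)
    (hm : ∀ w ∈ unitDisc, φ w ∈ unitDisc) (hw : w ∈ unitDisc) :
    ‖mobius (φ w) (φ 0)‖ ≤ ‖w‖ := by
  have h0m : (0 : ℂ) ∈ unitDisc := by simp [mem_uD]
  rw [mob_norm_symm]
  have h := Complex.norm_le_norm_of_mapsTo_ball (f := mobius (φ 0) ∘ φ) (R := 1) (z := w)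
    ((mob_diff (hm 0 h0m)).comp hφ hm) (by
      intro u hu
      exact Metric.ball_subset_closedBall (mob_mem (hm 0 h0m) (hm u hu)))
    (by simp [mob_self]) (mem_uD.mp hw)
  simpa using h

lemma elog_mul {x y : ℝ} : elog (x * y) = elog x + elog y := by
  unfold elog
  by_cases hx : x = 0
  · simp [hx]
  by_cases hy : y = 0
  · simp [hy]
  simp [hx, hy, Real.log_mul hx hy]

lemma elog_pow {x : ℝ} {k : ℕ} (hk : 0 < k) : elog (x ^ k) = ((k : ℝ) : EReal) * elog x := by
  unfold elog
  by_cases hx : x = 0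
  · have : (0 : ℝ) < k := by exact_mod_cast hk
    simp only [hx, zero_pow hk.ne', if_true]
    rw [EReal.coe_mul_bot_of_pos this]
  · simp [hx]

lemma elog_prod {N : ℕ} (m : Fin N → ℕ) (hm : ∀ j, 0 < m j) (x : Fin N → ℝ) :
    ∑ j, ((m j : ℝ) : EReal) * elog (x j) = elog (∏ j, x j ^ m j) := by
  have : ∀ s : Finset (Fin N), ∑ j ∈ s, ((m j : ℝ) : EReal) * elog (x j)
      = elog (∏ j ∈ s, x j ^ m j) := by
    intro s
    induction s using Finset.induction_on with
    | empty => simp [elog]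
    | insert a s ha ih => rw [Finset.sum_insert ha, Finset.prod_insert ha, elog_mul, ih, elog_pow (hm a)]
  exact this _

/-- Existence of a self-map of the disc fixing the origin and sending `ζ j` to `a j`. -/
def Reach {N : ℕ} (a ζ : Fin N → ℂ) : Prop :=
  (∀ j, ζ j ∈ unitDisc) ∧ ∃ f : ℂ → ℂ, DifferentiableOn ℂ f unitDisc ∧
    (∀ w ∈ unitDisc, f w ∈ unitDisc) ∧ f 0 = 0 ∧ ∀ j, f (ζ j) = a j

lemma Reach.refl {N : ℕ} {a : Fin N → ℂ} (ha : ∀ j, a j ∈ unitDisc) : Reach a a :=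
  ⟨ha, id, differentiableOn_id, fun _ h => h, rfl, fun _ => rfl⟩

lemma Reach.trans {N : ℕ} {a b c : Fin N → ℂ} (h1 : Reach a b) (h2 : Reach b c) : Reach a c := by
  obtain ⟨hb, f, fd, fm, f0, fe⟩ := h1
  obtain ⟨hc, g, gd, gm, g0, ge⟩ := h2
  exact ⟨hc, f ∘ g, fd.comp gd gm, fun w hw => fm _ (gm w hw), by simp [g0, f0],
    fun j => by simp [ge, fe]⟩

/-- The degree two Blaschke product `ζ (ζ - b) / (1 - b ζ)` hits `a` at the roots of a quadratic. -/
lemma reach_quad {N : ℕ} {a ζ : Fin N → ℂ} (hζ : ∀ j, ζ j ∈ unitDisc) {b : ℝ} (hb0 : 0 ≤ b)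
    (hb1 : b ≤ 1) (hq : ∀ j, ζ j ^ 2 - b * (1 - a j) * ζ j - a j = 0) : Reach a ζ := by
  have hden : ∀ w ∈ unitDisc, 1 - (b : ℂ) * w ≠ 0 := by
    intro w hw h
    rw [mem_uD] at hw
    have h1 : (b : ℂ) * w = 1 := (sub_eq_zero.mp h).symm
    have h2 : b * ‖w‖ = 1 := by
      have := congrArg norm h1
      simpa [abs_of_nonneg hb0] using this
    nlinarith [norm_nonneg w]
  refine ⟨hζ, fun w => w * (w - b) / (1 - b * w), ?_, ?_, by simp, ?_⟩
  · intro w hw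
    have := hden w hw
    apply DifferentiableAt.differentiableWithinAt
    fun_prop (disch := exact this)
  · intro w hw
    have hd := hden w hw
    rw [mem_uD] at hw ⊢
    have h0 : 0 < ‖1 - (b : ℂ) * w‖ := norm_pos_iff.mpr hd
    have h1 : ‖w - b‖ ^ 2 ≤ ‖1 - (b : ℂ) * w‖ ^ 2 := by
      have e : ‖1 - (b : ℂ) * w‖ ^ 2 - ‖w - b‖ ^ 2 = (1 - b ^ 2) * (1 - ‖w‖ ^ 2) := by
        simp only [Complex.sq_norm, Complex.normSq_apply]
        simp
        ring
      have : 0 ≤ (1 - b ^ 2) * (1 - ‖w‖ ^ 2) := by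
        apply mul_nonneg <;> nlinarith [norm_nonneg w]
      linarith
    have h2 : ‖w - b‖ ≤ ‖1 - (b : ℂ) * w‖ := le_of_sq_le_sq h1 h0.le
    rw [norm_div, norm_mul, div_lt_one h0]
    nlinarith [norm_nonneg w]
  · intro j
    have hd := hden _ (hζ j)
    simp only
    rw [div_eq_iff hd]
    linear_combination hq j

/-- `|r₁|² + |r₂|²` for the roots of the quadratic. -/
def qS (a : ℂ) (b : ℝ) : ℝ := (‖(b : ℂ) * (1 - a)‖ ^ 2 + ‖((b : ℂ) * (1 - a)) ^ 2 + 4 * a‖) / 2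

/-- The smaller root modulus. -/
def qrho (a : ℂ) (b : ℝ) : ℝ := (√(qS a b + 2 * ‖a‖) - √(qS a b - 2 * ‖a‖)) / 2

lemma qrho_cont (a : ℂ) : Continuous (qrho a) := by
  unfold qrho qS
  fun_prop

lemma qrho_zero (a : ℂ) : qrho a 0 = √‖a‖ := by
  have : qS a 0 = 2 * ‖a‖ := by simp [qS]; ring
  rw [qrho, this, sub_self, Real.sqrt_zero, sub_zero, ← two_mul, ← mul_assoc,
    Real.sqrt_mul (by norm_num), show (2 : ℝ) * 2 = 2 ^ 2 by norm_num,
    Real.sqrt_sq (by norm_num)]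
  ring

lemma qrho_one {a : ℂ} (ha : ‖a‖ < 1) : qrho a 1 = ‖a‖ := by
  have : qS a 1 = 1 + ‖a‖ ^ 2 := by
    have e : ((1 : ℝ) * (1 - a)) ^ 2 + 4 * a = (1 + a) ^ 2 := by push_cast; ring
    rw [qS, e, norm_pow]
    simp only [Complex.sq_norm, Complex.normSq_apply]
    simp
    ring
  rw [qrho, this, show 1 + ‖a‖ ^ 2 + 2 * ‖a‖ = (1 + ‖a‖) ^ 2 by ring,
    show 1 + ‖a‖ ^ 2 - 2 * ‖a‖ = (1 - ‖a‖) ^ 2 by ring, Real.sqrt_sq (by positivity),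
    Real.sqrt_sq (by linarith)]
  ring

lemma qrho_root (a : ℂ) (b : ℝ) : ∃ w : ℂ, w ^ 2 - b * (1 - a) * w - a = 0 ∧ ‖w‖ = qrho a b ∧
    ‖w‖ ^ 2 ≤ ‖a‖ := by
  obtain ⟨d, hd⟩ : ∃ d : ℂ, d ^ 2 = ((b : ℂ) * (1 - a)) ^ 2 + 4 * a :=
    IsAlgClosed.exists_pow_nat_eq _ (by norm_num)
  have main : ∀ r₁ r₂ : ℂ, r₁ + r₂ = b * (1 - a) → r₁ * r₂ = -a → ‖r₁‖ ≤ ‖r₂‖ →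
      ∃ w : ℂ, w ^ 2 - b * (1 - a) * w - a = 0 ∧ ‖w‖ = qrho a b ∧ ‖w‖ ^ 2 ≤ ‖a‖ := by
    intro r₁ r₂ hs hp hle
    have hn : ‖r₁‖ * ‖r₂‖ = ‖a‖ := by rw [← norm_mul, hp, norm_neg]
    have hS : qS a b = ‖r₁‖ ^ 2 + ‖r₂‖ ^ 2 := by
      have e : ((b : ℂ) * (1 - a)) ^ 2 + 4 * a = (r₁ - r₂) ^ 2 := by
        rw [← hs]; linear_combination 4 * hp
      rw [qS, e, ← hs, norm_pow]
      simp only [Complex.sq_norm, Complex.normSq_apply]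
      simp
      ring
    refine ⟨r₁, ?_, ?_, ?_⟩
    · rw [← hs]; linear_combination -hp
    · rw [qrho, hS, ← hn, show ‖r₁‖ ^ 2 + ‖r₂‖ ^ 2 + 2 * (‖r₁‖ * ‖r₂‖) = (‖r₁‖ + ‖r₂‖) ^ 2 by ring,
        show ‖r₁‖ ^ 2 + ‖r₂‖ ^ 2 - 2 * (‖r₁‖ * ‖r₂‖) = (‖r₂‖ - ‖r₁‖) ^ 2 by ring,
        Real.sqrt_sq (by positivity), Real.sqrt_sq (by linarith)]
      ring
    · rw [← hn]
      nlinarith [norm_nonneg r₁]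
  rcases le_total ‖((b : ℂ) * (1 - a) + d) / 2‖ ‖((b : ℂ) * (1 - a) - d) / 2‖ with h | h
  · exact main _ _ (by ring) (by linear_combination (-1 / 4) * hd) h
  · exact main _ _ (by ring) (by linear_combination (-1 / 4) * hd) h

lemma norm_lt_of_sq {w a : ℂ} (h : ‖w‖ ^ 2 ≤ ‖a‖) (ha : a ∈ unitDisc) : w ∈ unitDisc := by
  rw [mem_uD] at *
  nlinarith [norm_nonneg w]

/-- One step: any value between `F` and `√F` can be reached. -/
lemma one_step {N : ℕ} (m : Fin N → ℕ) (a : Fin N → ℂ) (ha : ∀ j, a j ∈ unitDisc) (c : ℝ)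
    (h1 : ∏ j, ‖a j‖ ^ m j ≤ c) (h2 : c ≤ √(∏ j, ‖a j‖ ^ m j)) :
    ∃ ζ, Reach a ζ ∧ ∏ j, ‖ζ j‖ ^ m j = c := by
  have hc : Continuous fun b : ℝ => ∏ j, qrho (a j) b ^ m j :=
    continuous_finsetProd _ fun j _ => (qrho_cont (a j)).pow _
  have e0 : ∏ j, qrho (a j) 0 ^ m j = √(∏ j, ‖a j‖ ^ m j) := by
    symm
    rw [Real.sqrt_eq_iff_mul_self_eq (by positivity) (Finset.prod_nonneg fun j _ => by
      rw [qrho_zero]; positivity), ← Finset.prod_mul_distrib]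
    refine Finset.prod_congr rfl fun j _ => ?_
    rw [qrho_zero, ← mul_pow, Real.mul_self_sqrt (norm_nonneg _)]
  have e1 : ∏ j, qrho (a j) 1 ^ m j = ∏ j, ‖a j‖ ^ m j :=
    Finset.prod_congr rfl fun j _ => by rw [qrho_one (mem_uD.mp (ha j))]
  obtain ⟨b, hb, hbc⟩ := intermediate_value_Icc' (zero_le_one' ℝ) hc.continuousOn
    (show c ∈ Set.Icc _ _ from ⟨by simpa only [e1] using h1, by simpa only [e0] using h2⟩)
  choose ζ hq hr hs using fun j => qrho_root (a j) b
  refine ⟨ζ, reach_quad (fun j => norm_lt_of_sq (hs j) (ha j)) hb.1 hb.2 hq, ?_⟩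
  rw [← hbc]
  exact Finset.prod_congr rfl fun j _ => by rw [hr]

lemma many_steps {N : ℕ} (m : Fin N → ℕ) (c : ℝ) (hc0 : 0 < c) (n : ℕ) :
    ∀ (a : Fin N → ℂ), (∀ j, a j ∈ unitDisc) → ∏ j, ‖a j‖ ^ m j ≤ c →
    c ^ (2 ^ n) ≤ ∏ j, ‖a j‖ ^ m j → ∃ ζ, Reach a ζ ∧ ∏ j, ‖ζ j‖ ^ m j = c := by
  induction n with
  | zero =>
    intro a ha h1 h2
    exact ⟨a, Reach.refl ha, le_antisymm h1 (by simpa using h2)⟩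
  | succ n ih =>
    intro a ha h1 h2
    set F := ∏ j, ‖a j‖ ^ m j with hF
    have hF0 : 0 ≤ F := by positivity
    have hF1 : F ≤ 1 := Finset.prod_le_one (fun j _ => by positivity)
      fun j _ => pow_le_one₀ (norm_nonneg _) (mem_uD.mp (ha j)).le
    have hFs : F ≤ √F := Real.le_sqrt_of_sq_le (by nlinarith)
    rcases le_total c √F with h | h
    · exact one_step m a ha c h1 h
    · obtain ⟨ξ, hξ, hξe⟩ := one_step m a ha √F hFs le_rfl
      obtain ⟨ζ, hζ, hζe⟩ := ih ξ hξ.1 (by rw [hξe]; exact h) (by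
        rw [hξe]
        apply Real.le_sqrt_of_sq_le
        rw [← pow_mul, ← pow_succ]
        exact h2)
      exact ⟨ζ, hξ.trans hζ, hζe⟩

lemma reach_pos {N : ℕ} (m : Fin N → ℕ) (c : ℝ) (hc0 : 0 < c) (hc1 : c < 1)
    (a : Fin N → ℂ) (ha : ∀ j, a j ∈ unitDisc) (h1 : ∏ j, ‖a j‖ ^ m j ≤ c)
    (h2 : 0 < ∏ j, ‖a j‖ ^ m j) : ∃ ζ, Reach a ζ ∧ ∏ j, ‖ζ j‖ ^ m j = c := by
  obtain ⟨n, hn⟩ := exists_pow_lt_of_lt_one h2 hc1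
  refine many_steps m c hc0 n a ha h1 (le_trans ?_ hn.le)
  exact pow_le_pow_of_le_one hc0.le hc1.le n.lt_two_pow_self.le

lemma reach_all {N : ℕ} (m : Fin N → ℕ) (c : ℝ) (hc0 : 0 < c) (hc1 : c < 1)
    (a : Fin N → ℂ) (ha : ∀ j, a j ∈ unitDisc) (h1 : ∏ j, ‖a j‖ ^ m j ≤ c) :
    ∃ ζ, Reach a ζ ∧ ∏ j, ‖ζ j‖ ^ m j = c := by
  rcases (show 0 ≤ ∏ j, ‖a j‖ ^ m j by positivity).eq_or_lt with h | h
  · obtain ⟨i, -, hi⟩ := Finset.prod_eq_zero_iff.mp h.symm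
    have hai : a i = 0 := by simpa using eq_zero_of_pow_eq_zero hi
    have hmi : m i ≠ 0 := by
      intro h0
      simp [h0] at hi
    have hex : ∀ j, ∃ w : ℂ, w ^ 2 - c * (1 - a j) * w - a j = 0 ∧ w ∈ unitDisc ∧ w ≠ 0 ∧
        (a j = 0 → w = c) := by
      intro j
      by_cases hj : a j = 0
      · refine ⟨c, ?_, ?_, ?_, fun _ => rfl⟩
        · rw [hj]; ring
        · rw [mem_uD]; simpa [abs_of_pos hc0] using hc1
        · exact_mod_cast hc0.ne'
      · obtain ⟨w, hw, -, hw2⟩ := qrho_root (a j) c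
        refine ⟨w, hw, norm_lt_of_sq hw2 (ha j), ?_, fun h => absurd h hj⟩
        rintro rfl
        apply hj
        simpa using hw
    choose ξ hq hd hne hz using hex
    have hr : Reach a ξ := reach_quad hd hc0.le hc1.le hq
    have hle : ∏ j, ‖ξ j‖ ^ m j ≤ c := by
      rw [← Finset.mul_prod_erase _ _ (Finset.mem_univ i)]
      have e1 : ‖ξ i‖ = c := by rw [hz i hai]; simp [abs_of_pos hc0]
      have e2 : ∏ j ∈ Finset.univ.erase i, ‖ξ j‖ ^ m j ≤ 1 :=
        Finset.prod_le_one (fun j _ => by positivity)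
          fun j _ => pow_le_one₀ (norm_nonneg _) (mem_uD.mp (hd j)).le
      have e3 : c ^ m i ≤ c := pow_le_of_le_one hc0.le hc1.le hmi
      rw [e1]
      have e4 : 0 ≤ ∏ j ∈ Finset.univ.erase i, ‖ξ j‖ ^ m j := by positivity
      have e5 : 0 ≤ c ^ m i := by positivity
      nlinarith
    obtain ⟨ζ, hζ, he⟩ := reach_pos m c hc0 hc1 ξ hd hle
      (Finset.prod_pos fun j _ => pow_pos (norm_pos_iff.mpr (hne j)) _)
    exact ⟨ζ, hr.trans hζ, he⟩
  · exact reach_pos m c hc0 hc1 a ha h1 h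

/-- The second component. -/
lemma exists_phi2 {N : ℕ} (m : Fin N → ℕ) (hm : ∀ j, 0 < m j) (ζ : Fin N → ℂ)
    (hζ : ∀ j, ζ j ∈ unitDisc) (z : ℂ) (hz : z ∈ unitDisc) (hle : ‖z‖ ≤ ∏ j, ‖ζ j‖ ^ m j) :
    ∃ φ : ℂ → ℂ, DifferentiableOn ℂ φ unitDisc ∧ (∀ w ∈ unitDisc, φ w ∈ unitDisc) ∧ φ 0 = z ∧
      ∀ j, ∀ k < m j, iteratedDeriv k φ (ζ j) = 0 := by
  set Q := ∏ j, ζ j ^ m j with hQ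
  have hQn : ‖Q‖ = ∏ j, ‖ζ j‖ ^ m j := by simp [hQ, norm_prod]
  rw [← hQn] at hle
  set B : ℂ → ℂ := fun w => ∏ j, mobius (ζ j) w ^ m j with hB
  have hBd : DifferentiableOn ℂ B unitDisc :=
    DifferentiableOn.fun_finsetProd fun j _ => (mob_diff (hζ j)).pow _
  have hB1 : ∀ w ∈ unitDisc, ‖B w‖ ≤ 1 := by
    intro w hw
    rw [hB, norm_prod]
    exact Finset.prod_le_one (fun j _ => norm_nonneg _) fun j _ => by
      rw [norm_pow]
      exact pow_le_one₀ (norm_nonneg _) (mem_uD.mp (mob_mem (hζ j) hw)).le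
  have hB0 : B 0 = Q := by simp [hB, hQ, mob_zero]
  have hφd : DifferentiableOn ℂ (fun w => z / Q * B w) unitDisc := hBd.const_mul _
  have hzQ : ‖z / Q‖ ≤ 1 := by
    rw [norm_div]
    exact div_le_one_of_le₀ hle (norm_nonneg _)
  refine ⟨fun w => z / Q * B w, hφd, ?_, ?_, ?_⟩
  · intro w hw
    rw [mem_uD, norm_mul]
    rcases isEmpty_or_nonempty (Fin N) with hN | ⟨⟨i⟩⟩
    · have : Q = 1 := by simp [hQ]
      rw [this, div_one]
      have := hB1 w hw
      have := mem_uD.mp hz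
      nlinarith [norm_nonneg z, norm_nonneg (B w)]
    · have : ‖B w‖ < 1 := by
        rw [hB, norm_prod]
        rw [← Finset.mul_prod_erase _ _ (Finset.mem_univ i)]
        have e2 : ∏ j ∈ Finset.univ.erase i, ‖mobius (ζ j) w ^ m j‖ ≤ 1 :=
          Finset.prod_le_one (fun j _ => norm_nonneg _)
            fun j _ => by
              rw [norm_pow]
              exact pow_le_one₀ (norm_nonneg _) (mem_uD.mp (mob_mem (hζ j) hw)).le
        have e3 : ‖mobius (ζ i) w ^ m i‖ < 1 := by
          rw [norm_pow]
          exact pow_lt_one₀ (norm_nonneg _) (mem_uD.mp (mob_mem (hζ i) hw)) (hm i).ne'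
        have := norm_nonneg (mobius (ζ i) w ^ m i)
        nlinarith
      nlinarith [norm_nonneg (z / Q), norm_nonneg (B w)]
  · simp only [hB0]
    by_cases hQ0 : Q = 0
    · rw [hQ0] at hle ⊢
      simpa using (show z = 0 by simpa using hle).symm
    · exact div_mul_cancel₀ z hQ0
  · intro j
    have hA := uD_anal hφd (hζ j)
    rw [← natCast_le_analyticOrderAt_iff_iteratedDeriv_eq_zero hA]
    set G : ℂ → ℂ := fun w => z / Q * ∏ i ∈ Finset.univ.erase j, mobius (ζ i) w ^ m i with hG
    have hGd : DifferentiableOn ℂ G unitDisc :=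
      (DifferentiableOn.fun_finsetProd fun i _ => (mob_diff (hζ i)).pow _).const_mul _
    have hM := uD_anal (mob_diff (hζ j)) (hζ j)
    have e : (fun w => z / Q * B w) = mobius (ζ j) ^ m j * G := by
      funext w
      simp only [hB, hG, Pi.mul_apply, Pi.pow_apply]
      rw [← Finset.mul_prod_erase _ _ (Finset.mem_univ j)]
      ring
    rw [e, analyticOrderAt_mul (hM.pow _) (uD_anal hGd (hζ j)), analyticOrderAt_pow hM,
      mob_order_self (hζ j)]
    simp

/-- `L_S = G_S` on the bidisc for poles `(a_j, 0)` with horizontal indicators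
`Ψ_{m_j}(w) = max {m_j log|w₁|, log|w₂|}`. -/
theorem lempert_eq_green_bidisc_horizontal
    (N : ℕ) (a : Fin N → ℂ) (ha : ∀ j, a j ∈ unitDisc) (hinj : Function.Injective a)
    (m : Fin N → ℕ) (hm : ∀ j, 0 < m j)
    (z₁ z₂ : ℂ) (hz₁ : z₁ ∈ unitDisc) (hz₂ : z₂ ∈ unitDisc) :
    sInf { t : EReal | ∃ (φ₁ φ₂ : ℂ → ℂ) (ζ : Fin N → ℂ),
        AnalyticDisc2 φ₁ φ₂ ∧ φ₁ 0 = z₁ ∧ φ₂ 0 = z₂ ∧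
        (∀ j, ζ j ∈ unitDisc) ∧
        (∀ j, φ₁ (ζ j) = a j) ∧
        (∀ j, ∀ k < m j, iteratedDeriv k φ₂ (ζ j) = 0) ∧
        t = ∑ j, ((m j : ℝ) : EReal) * elog ‖ζ j‖ }
      = max (∑ j, ((m j : ℝ) : EReal) * elog ‖mobius (a j) z₁‖)
            (elog ‖z₂‖) := by
  have h0m : (0 : ℂ) ∈ unitDisc := by simp [mem_uD]
  rw [elog_prod m hm fun j => ‖mobius (a j) z₁‖]
  set P := ∏ j, ‖mobius (a j) z₁‖ ^ m j with hP
  have hP0 : 0 ≤ P := by positivity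
  apply le_antisymm
  · set A : Fin N → ℂ := fun j => mobius z₁ (a j) with hA
    have hAd : ∀ j, A j ∈ unitDisc := fun j => mob_mem hz₁ (ha j)
    have hAP : ∏ j, ‖A j‖ ^ m j = P := by
      rw [hP]
      exact Finset.prod_congr rfl fun j _ => by rw [mob_norm_symm]
    obtain ⟨ζ, ⟨hζ, f, fd, fm, f0, fe⟩, hz, hv⟩ : ∃ ζ, Reach A ζ ∧
        ‖z₂‖ ≤ ∏ j, ‖ζ j‖ ^ m j ∧ ∏ j, ‖ζ j‖ ^ m j = max P ‖z₂‖ := by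
      rcases le_total ‖z₂‖ P with h | h
      · exact ⟨A, Reach.refl hAd, by rw [hAP]; exact h, by rw [hAP, max_eq_left h]⟩
      · rcases (norm_nonneg z₂).eq_or_lt with h0 | h0
        · have : P = 0 := le_antisymm (h0 ▸ h) hP0
          exact ⟨A, Reach.refl hAd, by rw [hAP, this, ← h0], by rw [hAP, this, ← h0, max_self]⟩
        · obtain ⟨ζ, hr, he⟩ := reach_all m ‖z₂‖ h0 (mem_uD.mp hz₂) A hAd (by rw [hAP]; exact h)
          exact ⟨ζ, hr, he.ge, by rw [he, max_eq_right h]⟩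
    obtain ⟨φ₂, pd, pm, p0, pz⟩ := exists_phi2 m hm ζ hζ z₂ hz₂ hz
    refine le_trans (sInf_le ⟨mobius z₁ ∘ f, φ₂, ζ, ⟨(mob_diff hz₁).comp fd fm, pd,
      fun w hw => mob_mem hz₁ (fm w hw), pm⟩, by simp [f0, mob_zero], p0, hζ, ?_, pz, rfl⟩) ?_
    · intro j
      rw [Function.comp_apply, fe, hA]
      exact mob_invol hz₁ (ha j)
    · rw [elog_prod m hm fun j => ‖ζ j‖, hv]
      rcases max_choice P ‖z₂‖ with h | h
      · rw [h]; exact le_max_left _ _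
      · rw [h]; exact le_max_right _ _
  · apply le_sInf
    rintro t ⟨φ₁, φ₂, ζ, ⟨d1, d2, m1, m2⟩, h1, h2, hζ, he, hord, rfl⟩
    rw [elog_prod m hm fun j => ‖ζ j‖]
    apply max_le
    · apply elog_mono hP0
      refine Finset.prod_le_prod (fun j _ => by positivity) fun j _ => ?_
      refine pow_le_pow_left₀ (norm_nonneg _) ?_ _
      have := schwarz_pick d1 m1 (hζ j)
      rwa [he, h1] at this
    · apply elog_mono (norm_nonneg _)
      rw [← h2]
      refine jensen_bound ζ hζ (fun i j hij => hinj ?_) _ m φ₂ rfl d2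
        (fun w hw => (mem_uD.mp (m2 w hw)).le) fun j => ?_
      · rw [← he i, ← he j, hij]
      · exact (natCast_le_analyticOrderAt_iff_iteratedDeriv_eq_zero (uD_anal d2 (hζ j))).mpr
          (hord j)
end
end
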